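/- Under the pyramid timeout scheme, a new timeout level L ≥ 1 is first selected exactly when every lower level has accumulated allocation 2^L: if ℓ_k = L with L ≥ 1 and ℓ_j ≠ L for all j < k, then n_l(k) = 2^L for every l < L, and consequently the total execution time satisfies N(k) = L · 2^L. -/

import Mathlib

/-- Given the list `prev = [ℓ_0, …, ℓ_{k-1}]` of previously chosen timeout levels,
the pyramid timeout scheme selects the largest `L ∈ ℕ` such that
`n_l ≥ n_L + 2^L` for all `l < L`, where `n_l = (count of `l` in `prev`) · 2^l`.
(Every valid `L ≥ 1` satisfies `2^L ≤ n_0 ≤ prev.length`, hence `L ≤ prev.length`,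
so `Nat.findGreatest` with bound `prev.length` computes this largest `L`.) -/
def pyrNext (prev : List ℕ) : ℕ :=
  Nat.findGreatest
    (fun L => ∀ l < L, prev.count l * 2 ^ l ≥ prev.count L * 2 ^ L + 2 ^ L)
    prev.length

/-- `pyrSeq k = [ℓ_0, …, ℓ_{k-1}]`, the first `k` timeout levels of the pyramid scheme. -/
def pyrSeq : ℕ → List ℕ
  | 0 => []
  | k + 1 => pyrSeq k ++ [pyrNext (pyrSeq k)]

/-- `ℓ_k`, the timeout level selected at step `k`. -/
def pyrLevel (k : ℕ) : ℕ := pyrNext (pyrSeq k)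

/-- `n_l(k)`, the total execution time allocated to level `l` during the first `k` steps. -/
def pyrAlloc (l k : ℕ) : ℕ := (pyrSeq k).count l * 2 ^ l

/-- `N(k) = Σ_{j<k} 2^{ℓ_j}`, the total execution time after `k` steps. -/
def pyrTotal (k : ℕ) : ℕ := ∑ j ∈ Finset.range k, 2 ^ pyrLevel j

theorem Nat.add_le_of_lt_of_dvd {a b d : ℕ} (h : a < b) (ha : d ∣ a) (hb : d ∣ b) :
    a + d ≤ b := by
  have := Nat.le_of_dvd (Nat.sub_pos_of_lt h) (Nat.dvd_sub hb ha)
  omega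

theorem pyrSeq_eq_map (k : ℕ) : pyrSeq k = (List.range k).map pyrLevel := by
  induction k with
  | zero => rfl
  | succ k ih => rw [List.range_succ, List.map_append, ← ih]; rfl

theorem pyrAlloc_succ (l k : ℕ) :
    pyrAlloc l (k + 1) = pyrAlloc l k + if pyrLevel k = l then 2 ^ l else 0 := by
  have h : pyrSeq (k + 1) = pyrSeq k ++ [pyrLevel k] := rfl
  unfold pyrAlloc
  rw [h, List.count_append, List.count_singleton]
  split_ifs <;> simp_all [add_mul]

theorem pyrAlloc_pos_iff {l k : ℕ} : 0 < pyrAlloc l k ↔ ∃ j < k, pyrLevel j = l := by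
  simp [pyrAlloc, pyrSeq_eq_map, List.count_pos_iff]

theorem two_pow_dvd_pyrAlloc {m l : ℕ} (h : m ≤ l) (k : ℕ) : 2 ^ m ∣ pyrAlloc l k :=
  (pow_dvd_pow 2 h).mul_left _

/-- The selected level satisfies the selection condition. -/
theorem pyrAlloc_pyrLevel_add_le {l k : ℕ} (h : l < pyrLevel k) :
    pyrAlloc (pyrLevel k) k + 2 ^ pyrLevel k ≤ pyrAlloc l k :=
  Nat.findGreatest_spec
    (P := fun L => ∀ l < L, (pyrSeq k).count l * 2 ^ l ≥ (pyrSeq k).count L * 2 ^ L + 2 ^ L)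
    (Nat.zero_le (pyrSeq k).length) (fun _ hl => absurd hl (Nat.not_lt_zero _)) l h

/-- The selected level is maximal among those that satisfy the selection condition. -/
theorem le_pyrLevel {L k : ℕ} (h : ∀ l < L, pyrAlloc L k + 2 ^ L ≤ pyrAlloc l k) :
    L ≤ pyrLevel k := by
  refine Nat.le_findGreatest ?_ h
  rcases Nat.eq_zero_or_pos L with rfl | hL
  · exact Nat.zero_le _
  · have h0 := h 0 hL
    have hc : pyrAlloc 0 k ≤ (pyrSeq k).length := by
      simpa [pyrAlloc] using List.count_le_length (a := 0) (l := pyrSeq k)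
    have := Nat.lt_two_pow_self (n := L)
    omega

/-- A lower level is never more than one execution of a higher level ahead of it. -/
theorem pyrAlloc_le_add_two_pow (k : ℕ) :
    ∀ {l L : ℕ}, l < L → pyrAlloc l k ≤ pyrAlloc L k + 2 ^ L := by
  induction k with
  | zero => intro l L _; simp [pyrAlloc, pyrSeq]
  | succ k ih =>
    intro l L
    induction L using Nat.strong_induction_on with
    | _ L ihL =>
    intro hlL
    by_contra! hlt
    have hold := ih hlL
    rw [pyrAlloc_succ, pyrAlloc_succ] at hlt
    by_cases hl : pyrLevel k = l
    swap
    · rw [if_neg hl] at hlt; omega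
    rw [if_pos hl, if_neg (by omega)] at hlt
    have heq : pyrAlloc l k = pyrAlloc L k + 2 ^ L := by
      refine le_antisymm hold (not_lt.1 fun hlt' => ?_)
      have := Nat.add_le_of_lt_of_dvd hlt' (two_pow_dvd_pyrAlloc le_rfl k)
        ((two_pow_dvd_pyrAlloc hlL.le k).add (pow_dvd_pow 2 hlL.le))
      omega
    have hvalid : ∀ m < L, pyrAlloc L k + 2 ^ L ≤ pyrAlloc m k := by
      intro m hm
      rw [← heq]
      rcases lt_trichotomy m l with hml | rfl | hlm
      · have := pyrAlloc_pyrLevel_add_le (k := k) (l := m) (by omega)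
        rw [hl] at this
        omega
      · exact le_rfl
      · have hnew := ihL m hm hlm
        rw [pyrAlloc_succ, pyrAlloc_succ, if_pos hl, if_neg (by omega)] at hnew
        refine not_lt.1 fun hlt' => ?_
        have := Nat.add_le_of_lt_of_dvd hlt' (two_pow_dvd_pyrAlloc le_rfl k)
          (heq ▸ (two_pow_dvd_pyrAlloc hm.le k).add (pow_dvd_pow 2 hm.le))
        have := Nat.two_pow_pos l
        omega
    have := le_pyrLevel hvalid
    omega

/-- The total execution time is the sum of the allocations of all used levels. -/
theorem pyrTotal_eq_sum_pyrAlloc {k L : ℕ} (h : ∀ j < k, pyrLevel j < L) :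
    pyrTotal k = ∑ l ∈ Finset.range L, pyrAlloc l k := by
  induction k with
  | zero => simp [pyrTotal, pyrAlloc, pyrSeq]
  | succ k ih =>
    have hk := h k k.lt_succ_self
    have ih' := ih fun j hj => h j (hj.trans k.lt_succ_self)
    unfold pyrTotal at ih' ⊢
    simp [Finset.sum_range_succ, pyrAlloc_succ, Finset.sum_add_distrib, ih', hk]

/-- If a level has not been used yet, neither has any higher level. -/
theorem pyrLevel_lt_of_unused {k L : ℕ} (h : ∀ j < k, pyrLevel j ≠ L) :
    ∀ j < k, pyrLevel j < L := by
  intro j hj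
  refine lt_of_le_of_ne (not_lt.1 fun hL => ?_) (h j hj)
  have hpos : 0 < pyrAlloc L j :=
    (Nat.add_pos_right _ (Nat.two_pow_pos _)).trans_le (pyrAlloc_pyrLevel_add_le hL)
  obtain ⟨i, hi, hiL⟩ := pyrAlloc_pos_iff.1 hpos
  exact h i (hi.trans hj) hiL

/-- Under the pyramid timeout scheme, a new timeout level `L ≥ 1` is first selected
exactly when every lower level has accumulated allocation `2^L`: if `ℓ_k = L` with
`L ≥ 1` and `ℓ_j ≠ L` for all `j < k`, then `n_l(k) = 2^L` for every `l < L`, and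
consequently the total execution time satisfies `N(k) = L · 2^L`. -/
theorem pyramid_new_level :
    ∀ k L : ℕ, 1 ≤ L → pyrLevel k = L → (∀ j < k, pyrLevel j ≠ L) →
      (∀ l < L, pyrAlloc l k = 2 ^ L) ∧ pyrTotal k = L * 2 ^ L := by
  intro k L _ hk hnew
  have hL : pyrAlloc L k = 0 :=
    Nat.eq_zero_of_not_pos fun hpos => by
      obtain ⟨j, hj, hjL⟩ := pyrAlloc_pos_iff.1 hpos
      exact hnew j hj hjL
  have halloc : ∀ l < L, pyrAlloc l k = 2 ^ L := by
    intro l hl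
    have hle := pyrAlloc_le_add_two_pow k hl
    have hge := pyrAlloc_pyrLevel_add_le (k := k) (hk ▸ hl)
    rw [hk] at hge
    omega
  refine ⟨halloc, ?_⟩
  rw [pyrTotal_eq_sum_pyrAlloc (pyrLevel_lt_of_unused hnew),
    Finset.sum_congr rfl fun l hl => halloc l (Finset.mem_range.1 hl)]
  simp
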